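/- arXiv:2112.14317 — 3 statements merged into one kernel-verified Lean document; each statement's English description precedes it below -/
import Mathlib

section
/- Let b ≥ 1, let X := Fin (2*b) → ZMod 2 and Y := Fin b → ZMod 2, and let h : X → Y. Define the oracle map O_h : (X × Y → ℂ) → (X × Y → ℂ) by (O_h ψ) (x, y) := ψ (x, y + h x), the phase map D_f : (X × Y → ℂ) → (X × Y → ℂ) for f : X → Bool by (D_f ψ) (x, y) := (if f x then -1 else 1) * ψ (x, y), and the data-register phase map P_f : (X → ℂ) → (X → ℂ) by (P_f φ) x := (if f x then -1 else 1) * φ x. Then for every φ : X → ℂ and every f : X → Bool, O_h (D_f (O_h (φ ⊗ δ₀))) = (P_f φ) ⊗ δ₀, where (φ ⊗ δ₀) (x, y) := φ x * (if y = 0 then 1 else 0). -/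
/-- The data register: bit strings of length `2b`. -/
abbrev X (b : ℕ) := Fin (2 * b) → ZMod 2

/-- The commitment register: bit strings of length `b`. -/
abbrev Y (b : ℕ) := Fin b → ZMod 2

/-- The quantum oracle `O_h` for a classical function `h : X → Y`:
`(O_h ψ) (x, y) = ψ (x, y + h x)` (bitwise XOR with `h x` on the second register). -/
def oracleO {b : ℕ} (h : X b → Y b) (ψ : X b × Y b → ℂ) : X b × Y b → ℂ :=
  fun p => ψ (p.1, p.2 + h p.1)

/-- The phase unitary `D_f` on both registers: `(D_f ψ) (x, y) = (-1)^{f x} ψ (x, y)`. -/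
def phaseD {b : ℕ} (f : X b → Bool) (ψ : X b × Y b → ℂ) : X b × Y b → ℂ :=
  fun p => (if f p.1 then -1 else 1) * ψ p

/-- The phase unitary `P_f` on the data register only: `(P_f φ) x = (-1)^{f x} φ x`. -/
def phaseP {b : ℕ} (f : X b → Bool) (φ : X b → ℂ) : X b → ℂ :=
  fun x => (if f x then -1 else 1) * φ x

/-- Tensoring a data state `φ` with the all-zero commitment register `δ₀`:
`(φ ⊗ δ₀) (x, y) = φ x · [y = 0]`. -/
def tensorDelta {b : ℕ} (φ : X b → ℂ) : X b × Y b → ℂ :=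
  fun p => φ p.1 * (if p.2 = 0 then 1 else 0)

/-- Bitwise XOR with a fixed string is an involution. -/
lemma add_add_self_eq {b : ℕ} (y z : Y b) : y + z + z = y := by
  funext i
  rw [Pi.add_apply, Pi.add_apply, add_assoc, CharTwo.add_self_eq_zero, add_zero]

/-- The oracle `O_h` is its own inverse. -/
lemma oracleO_oracleO {b : ℕ} (h : X b → Y b) (ψ : X b × Y b → ℂ) :
    oracleO h (oracleO h ψ) = ψ := by
  funext p
  simp only [oracleO, add_add_self_eq]

/-- A phase depending on the data register only commutes with the oracle. -/
lemma oracleO_phaseD {b : ℕ} (h : X b → Y b) (f : X b → Bool) (ψ : X b × Y b → ℂ) :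
    oracleO h (phaseD f ψ) = phaseD f (oracleO h ψ) :=
  rfl

lemma phaseD_tensorDelta {b : ℕ} (f : X b → Bool) (φ : X b → ℂ) :
    phaseD f (tensorDelta φ) = tensorDelta (phaseP f φ) := by
  funext p
  simp only [phaseD, tensorDelta, phaseP, mul_assoc]

/-- **The phase attack on the naive quantum Merkle tree.** Committing with `O_h`,
applying the phase unitary `D_f`, and decommitting with `O_h` again returns the
commitment register exactly to `δ₀` while changing the data state from `φ` to `P_f φ`:
`O_h (D_f (O_h (φ ⊗ δ₀))) = (P_f φ) ⊗ δ₀`. -/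
theorem phase_attack (b : ℕ) (hb : 1 ≤ b) (h : X b → Y b) (f : X b → Bool)
    (φ : X b → ℂ) :
    oracleO h (phaseD f (oracleO h (tensorDelta φ))) = tensorDelta (phaseP f φ) := by
  rw [oracleO_phaseD, oracleO_oracleO, phaseD_tensorDelta]
end

section
/- Let X and Y be nonempty finite types, let t be a natural number, and let x : Fin t → X be injective. Under the uniform probability mass function on the set of all functions h : X → Y (PMF.uniformOfFintype (X → Y)), the probability of the event {h | ∃ i j : Fin t, i ≠ j ∧ h (x i) = h (x j)} is at most t * (t - 1) / (2 * Fintype.card Y). -/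
/-- At most a `1 / |Y|` fraction of all functions `X → Y` agree on two given distinct points. -/
theorem card_filter_apply_eq_apply_mul_card_le {X Y : Type*} [Fintype X] [Fintype Y]
    [DecidableEq X] [DecidableEq Y] {a b : X} (hab : a ≠ b) :
    (Finset.univ.filter fun h : X → Y => h a = h b).card * Fintype.card Y ≤
      Fintype.card (X → Y) := by
  rw [← Finset.card_univ (α := Y), ← Finset.card_product, ← Finset.card_univ (α := X → Y)]
  refine Finset.card_le_card_of_injOn (fun p => Function.update p.1 a p.2) (by simp) ?_
  rintro ⟨h, y⟩ hh ⟨g, z⟩ hg heq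
  simp only [Finset.coe_product, Set.mem_prod, Finset.mem_coe, Finset.mem_filter,
    Finset.mem_univ, true_and, and_true] at hh hg
  have off : ∀ c, c ≠ a → h c = g c := fun c hc => by simpa [hc] using congrFun heq c
  refine Prod.ext (funext fun c => ?_) (by simpa using congrFun heq a)
  rcases eq_or_ne c a with rfl | hc
  · exact hh.trans ((off b hab.symm).trans hg.symm)
  · exact off c hc

/-- The number of functions with a collision among `t` distinct points, in the form of the
birthday bound with denominators cleared. -/
theorem card_filter_exists_collision_mul_le {X Y : Type*} [Fintype X] [Fintype Y]
    [DecidableEq X] [DecidableEq Y] {t : ℕ} {x : Fin t → X} (hx : Function.Injective x) :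
    (Finset.univ.filter fun h : X → Y => ∃ i j : Fin t, i ≠ j ∧ h (x i) = h (x j)).card *
      (2 * Fintype.card Y) ≤ t * (t - 1) * Fintype.card (X → Y) := by
  have hsub : (Finset.univ.filter fun h : X → Y => ∃ i j : Fin t, i ≠ j ∧ h (x i) = h (x j)) ⊆
      Finset.univ.biUnion fun j : Fin t => (Finset.Iio j).biUnion fun i =>
        Finset.univ.filter fun h : X → Y => h (x i) = h (x j) := by
    intro h hh
    simp only [Finset.mem_filter, Finset.mem_univ, true_and, Finset.mem_biUnion,
      Finset.mem_Iio] at hh ⊢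
    obtain ⟨i, j, hij, e⟩ := hh
    rcases lt_or_gt_of_ne hij with hlt | hlt
    exacts [⟨j, i, hlt, e⟩, ⟨i, j, hlt, e.symm⟩]
  have hcard := (Finset.card_le_card hsub).trans <| Finset.card_biUnion_le.trans <|
    Finset.sum_le_sum fun j _ => Finset.card_biUnion_le
  calc _ ≤ (∑ j : Fin t, ∑ i ∈ Finset.Iio j,
          (Finset.univ.filter fun h : X → Y => h (x i) = h (x j)).card) *
            (2 * Fintype.card Y) := Nat.mul_le_mul_right _ hcard
    _ = (∑ j : Fin t, ∑ i ∈ Finset.Iio j,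
          (Finset.univ.filter fun h : X → Y => h (x i) = h (x j)).card * Fintype.card Y) * 2 := by
        simp only [← Finset.sum_mul]
        ring
    _ ≤ (∑ j : Fin t, ∑ _i ∈ Finset.Iio j, Fintype.card (X → Y)) * 2 := by
        gcongr with j _ i hi
        exact card_filter_apply_eq_apply_mul_card_le (hx.ne (Finset.mem_Iio.mp hi).ne)
    _ = (∑ j ∈ Finset.range t, j) * 2 * Fintype.card (X → Y) := by
        simp only [Finset.sum_const, Fin.card_Iio, smul_eq_mul, ← Finset.sum_mul,
          Fin.sum_univ_eq_sum_range (fun n => n)]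
        ring
    _ = t * (t - 1) * Fintype.card (X → Y) := by rw [Finset.sum_range_id_mul_two]

/-- **The birthday bound for a uniformly random function.** Let `h : X → Y` be a
uniformly random function and let `x 0, …, x (t-1)` be `t` distinct query points.
The probability that two distinct queried points collide under `h` is at most
`t (t − 1) / (2 |Y|)`. -/
theorem birthday_bound (X Y : Type) [Fintype X] [Fintype Y] [Nonempty X] [Nonempty Y]
    [DecidableEq X] [DecidableEq Y] (t : ℕ) (x : Fin t → X)
    (hx : Function.Injective x) :
    (PMF.uniformOfFintype (X → Y)).toOuterMeasure
        {h : X → Y | ∃ i j : Fin t, i ≠ j ∧ h (x i) = h (x j)} ≤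
      ((t * (t - 1) : ℕ) : ENNReal) / ((2 * Fintype.card Y : ℕ) : ENNReal) := by
  rw [PMF.toOuterMeasure_uniformOfFintype_apply]
  refine ENNReal.div_le_of_le_mul ?_
  rw [ENNReal.mul_comm_div, ← mul_div_assoc,
    ENNReal.le_div_iff_mul_le (by simp) (Or.inl (ENNReal.natCast_ne_top _))]
  have key := card_filter_exists_collision_mul_le (Y := Y) hx
  rw [← Fintype.card_subtype] at key
  exact_mod_cast key
end

section
/- Define P : ℕ → Finset ℕ by P u = {1} if u ≤ 1, and P u = insert u (P (u / 2)) otherwise, and R : ℕ → Finset ℕ by R u = (P u) ∪ (P u).biUnion (fun v => {2*v, 2*v + 1}). Let d : ℕ and let S be a finite set of natural numbers with S ⊆ Finset.Icc 1 (2^(d+1) - 1). Then (S.biUnion R).card ≤ S.card * (2 * d + 3). -/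
/-- The ancestor path of node `u` in the infinite binary tree whose root is labeled `1`
and where the parent of `u > 1` is `⌊u/2⌋`: `P u` consists of `u` and all its ancestors. -/
def ancestorPath (u : ℕ) : Finset ℕ :=
  if h : u ≤ 1 then {1} else insert u (ancestorPath (u / 2))
decreasing_by exact Nat.div_lt_self (by omega) (by omega)

/-- `R u`: the nodes that are on the ancestor path of `u` or whose parent is on the
ancestor path of `u` (the children of `v` being `2v` and `2v + 1`). -/
def revealSet (u : ℕ) : Finset ℕ :=
  ancestorPath u ∪ (ancestorPath u).biUnion (fun v => {2 * v, 2 * v + 1})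

theorem ancestorPath_of_le_one {u : ℕ} (hu : u ≤ 1) : ancestorPath u = {1} := by
  rw [ancestorPath, dif_pos hu]

theorem ancestorPath_of_one_lt {u : ℕ} (hu : 1 < u) :
    ancestorPath u = insert u (ancestorPath (u / 2)) := by
  rw [ancestorPath, dif_neg (not_le.mpr hu)]

theorem self_mem_ancestorPath {u : ℕ} (hu : 0 < u) : u ∈ ancestorPath u := by
  rcases Nat.lt_or_ge 1 u with h | h
  · simp [ancestorPath_of_one_lt h]
  · rw [ancestorPath_of_le_one h, le_antisymm h hu, Finset.mem_singleton]

/-- Passing from the parent of `u` to `u` reveals at most the two children of `u` in addition,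
since `u` itself is already revealed as a child of its parent. -/
theorem revealSet_subset_of_one_lt {u : ℕ} (hu : 1 < u) :
    revealSet u ⊆ revealSet (u / 2) ∪ {2 * u, 2 * u + 1} := by
  have hself : u ∈ revealSet (u / 2) := by
    refine Finset.mem_union_right _ (Finset.mem_biUnion.mpr
      ⟨u / 2, self_mem_ancestorPath (by omega), ?_⟩)
    simp only [Finset.mem_insert, Finset.mem_singleton]
    omega
  rw [revealSet, ancestorPath_of_one_lt hu, Finset.biUnion_insert]
  refine Finset.union_subset (Finset.insert_subset (Finset.mem_union_left _ hself) ?_)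
    (Finset.union_subset Finset.subset_union_right ?_)
  · exact Finset.subset_union_left.trans Finset.subset_union_left
  · exact Finset.subset_union_right.trans Finset.subset_union_left

theorem card_revealSet_le {d u : ℕ} (hu : u < 2 ^ (d + 1)) :
    (revealSet u).card ≤ 2 * d + 3 := by
  induction d generalizing u with
  | zero =>
    simp [revealSet, ancestorPath_of_le_one (show u ≤ 1 by omega)]
  | succ d ih =>
    rcases Nat.lt_or_ge 1 u with h | h
    · calc (revealSet u).card
          ≤ (revealSet (u / 2) ∪ {2 * u, 2 * u + 1}).card :=
            Finset.card_le_card (revealSet_subset_of_one_lt h)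
        _ ≤ (revealSet (u / 2)).card + ({2 * u, 2 * u + 1} : Finset ℕ).card :=
            Finset.card_union_le _ _
        _ ≤ (2 * d + 3) + 2 :=
            Nat.add_le_add (ih (by rw [pow_succ] at hu; omega)) Finset.card_le_two
        _ = 2 * (d + 1) + 3 := by ring
    · exact (ih (h.trans_lt (Nat.one_lt_two_pow (Nat.succ_ne_zero d)))).trans (by omega)

/-- **Size of the decommitment set of a set of nodes.** If `S` is a set of nodes of the
perfect binary tree of depth `d` (whose nodes are labeled `1` through `2^(d+1) − 1`),
then `|R_S| = |⋃_{u ∈ S} R u| ≤ |S| · (2d + 3)`. -/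
theorem revealSet_biUnion_card_le (d : ℕ) (S : Finset ℕ)
    (hS : S ⊆ Finset.Icc 1 (2 ^ (d + 1) - 1)) :
    (S.biUnion revealSet).card ≤ S.card * (2 * d + 3) := by
  refine Finset.card_biUnion_le_card_mul _ _ _ fun u hu => card_revealSet_le ?_
  have h := Finset.mem_Icc.mp (hS hu)
  omega
end
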